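/- Let A = {1,2}. For the elementary abelian group C_3^3 one has D_{A,1}(C_3^3) = 4, D_{A,2}(C_3^3) = 7, D_{A,3}(C_3^3) = 9, D_{A,4}(C_3^3) = 12, and D_{A,m}(C_3^3) = 4 + 2m for every m ≥ 5. -/

import Mathlib

open scoped BigOperators

/-- `l` encodes a `W`-weighted zero-subsum of the sequence (multiset) `S`:
a nonempty list of (weight, group element) pairs with weights in `W`, whose
group elements form a sub-multiset of `S` and whose weighted sum is zero. -/
def IsWZeroSubsum {G : Type*} [AddCommGroup G] (W : Set ℤ) (S : Multiset G)
    (l : List (ℤ × G)) : Prop :=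
  l ≠ [] ∧ (∀ p ∈ l, p.1 ∈ W) ∧ (↑(l.map Prod.snd) : Multiset G) ≤ S ∧
    (l.map fun p => p.1 • p.2).sum = 0

/-- `S` has a `W`-weighted zero-subsum whose length lies in `L`. -/
def HasWZeroSubsumLen {G : Type*} [AddCommGroup G] (W : Set ℤ) (S : Multiset G)
    (L : Set ℕ) : Prop :=
  ∃ l : List (ℤ × G), IsWZeroSubsum W S l ∧ l.length ∈ L

/-- `S` has `m` pairwise disjoint `W`-weighted zero-subsums. -/
def HasDisjointWZeroSubsums {G : Type*} [AddCommGroup G] (W : Set ℤ) (S : Multiset G)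
    (m : ℕ) : Prop :=
  ∃ ls : List (List (ℤ × G)), ls.length = m ∧
    (∀ l ∈ ls, l ≠ [] ∧ (∀ p ∈ l, p.1 ∈ W) ∧ (l.map fun p => p.1 • p.2).sum = 0) ∧
    (↑(ls.flatten.map Prod.snd) : Multiset G) ≤ S

/-- The `m`-wise `W`-weighted Davenport constant `D_{W,m}(G)`. -/
noncomputable def DW (W : Set ℤ) (G : Type*) [AddCommGroup G] (m : ℕ) : ℕ :=
  sInf {n : ℕ | ∀ S : Multiset G, n ≤ Multiset.card S → HasDisjointWZeroSubsums W S m}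

/-- The `L`-constrained `W`-weighted Davenport constant `s_{W,L}(G)`, valued in `ℕ∞`. -/
noncomputable def sWL (W : Set ℤ) (G : Type*) [AddCommGroup G] (L : Set ℕ) : ℕ∞ :=
  sInf {N : ℕ∞ | ∃ n : ℕ, N = (n : ℕ∞) ∧
    ∀ S : Multiset G, n ≤ Multiset.card S → HasWZeroSubsumLen W S L}

/-- The `d`-constrained `W`-weighted Davenport constant `s_{W,≤d}(G)`. -/
noncomputable def sWle (W : Set ℤ) (G : Type*) [AddCommGroup G] (d : ℕ) : ℕ∞ :=
  sWL W G {t | 1 ≤ t ∧ t ≤ d}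

/-- `e_W(G)`: the smallest `t ≥ 1` such that some `t` weights from `W` sum to a
multiple of `exp(G)`. -/
noncomputable def eW (W : Set ℤ) (G : Type*) [AddCommGroup G] : ℕ :=
  sInf {t : ℕ | 1 ≤ t ∧ ∃ w : Fin t → ℤ, (∀ i, w i ∈ W) ∧
    ((AddMonoid.exponent G : ℤ) ∣ ∑ i, w i)}

/-- `W` is multiplicatively closed modulo `n`. -/
def MulClosedMod (W : Set ℤ) (n : ℕ) : Prop :=
  ∀ w ∈ W, ∀ w' ∈ W, ∃ u ∈ W, (n : ℤ) ∣ w * w' - u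

abbrev GG := Fin 3 → ZMod 3

def Zs (l : List (ℤ × GG)) : Prop :=
  l ≠ [] ∧ (∀ p ∈ l, p.1 ∈ ({1, 2} : Set ℤ)) ∧ (l.map fun p => p.1 • p.2).sum = 0

def UU (n m : ℕ) : Prop :=
  ∀ S : Multiset GG, n ≤ Multiset.card S → HasDisjointWZeroSubsums {1, 2} S m

theorem has_cons {S T : Multiset GG} {m : ℕ} {l : List (ℤ × GG)} (hl : Zs l)
    (hT : HasDisjointWZeroSubsums {1, 2} T m)
    (h : (↑(l.map Prod.snd) : Multiset GG) + T ≤ S) :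
    HasDisjointWZeroSubsums {1, 2} S (m + 1) := by
  obtain ⟨ls, h1, h2, h3⟩ := hT
  refine ⟨l :: ls, by simp [h1], ?_, ?_⟩
  · intro a ha
    rcases List.mem_cons.1 ha with rfl | ha
    · exact hl
    · exact h2 a ha
  · rw [List.flatten_cons, List.map_append, ← Multiset.coe_add]
    exact (add_le_add_right h3 _).trans h

theorem has_zero (S : Multiset GG) : HasDisjointWZeroSubsums {1, 2} S 0 :=
  ⟨[], rfl, by simp, by simp⟩

theorem has_remove {S : Multiset GG} {n m : ℕ} {l : List (ℤ × GG)} (hl : Zs l)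
    (h : (↑(l.map Prod.snd) : Multiset GG) ≤ S) (hU : UU n m)
    (hc : n + l.length ≤ Multiset.card S) :
    HasDisjointWZeroSubsums {1, 2} S (m + 1) := by
  obtain ⟨T, rfl⟩ := Multiset.le_iff_exists_add.1 h
  refine has_cons hl (hU T ?_) le_rfl
  simp at hc
  omega

def Clean (S : Multiset GG) : Prop := 0 ∉ S ∧ S.Nodup ∧ ∀ x ∈ S, -x ∉ S

theorem three_smul_GG (x : GG) : x + x + x = 0 := by
  revert x; decide

theorem two_zsmul_GG (x : GG) : (2 : ℤ) • x = -x := by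
  rw [two_zsmul]; exact eq_neg_of_add_eq_zero_left (three_smul_GG x)

theorem neg_ne_GG (x : GG) (h : x ≠ 0) : -x ≠ x := by
  revert x; decide

theorem dich (S : Multiset GG) :
    (∃ l, Zs l ∧ l.length ≤ 2 ∧ (↑(l.map Prod.snd) : Multiset GG) ≤ S) ∨ Clean S := by
  by_cases h0 : (0 : GG) ∈ S
  · left
    refine ⟨[(1, 0)], ⟨by simp, by simp, by simp⟩, by simp, ?_⟩
    simpa using h0
  by_cases hn : S.Nodup
  · by_cases hx : ∀ x ∈ S, -x ∉ S
    · exact Or.inr ⟨h0, hn, hx⟩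
    · left
      push Not at hx
      obtain ⟨x, hx, hx'⟩ := hx
      refine ⟨[(1, x), (1, -x)], ⟨by simp, by simp, by simp⟩, by simp, ?_⟩
      have hne : -x ≠ x := neg_ne_GG x (by rintro rfl; exact h0 hx)
      rw [Multiset.le_iff_subset]
      · intro y hy
        simp at hy
        rcases hy with rfl | rfl <;> assumption
      · simpa using hne.symm
  · left
    rw [Multiset.nodup_iff_le] at hn
    push Not at hn
    obtain ⟨x, hx⟩ := hn
    refine ⟨[(1, x), (2, x)], ⟨by simp, by simp, ?_⟩, by simp, hx⟩
    simp only [List.map_cons, List.map_nil, List.sum_cons, List.sum_nil, add_zero, two_zsmul_GG, one_zsmul]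
    exact add_neg_cancel x

theorem UU_step {n n' m : ℕ} (hU : UU n m) (hn : n + 2 ≤ n')
    (hC : ∀ S, Clean S → n' ≤ Multiset.card S → HasDisjointWZeroSubsums {1, 2} S (m + 1)) :
    UU n' (m + 1) := by
  intro S hS
  rcases dich S with ⟨l, h1, h2, h3⟩ | h
  · exact has_remove h1 h3 hU (by omega)
  · exact hC S h hS

theorem UU_one : UU 4 1 := by
  refine UU_step (n := 0) (m := 0) (fun S _ => has_zero S) (by norm_num) ?_
  intro S hS hc
  let F : Finset GG := ⟨S, hS.2.1⟩
  obtain ⟨f, h1, x, hx, hfx⟩ := Module.exists_nontrivial_relation_of_finrank_lt_card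
    (R := ZMod 3) (M := GG) (t := F) (by simp [F]; omega)
  let T := F.filter (fun x => f x ≠ 0)
  have hval : ∀ a : ZMod 3, a ≠ 0 → ((a.val : ℤ) = 1 ∨ (a.val : ℤ) = 2) := by decide
  have hsm : ∀ (a : ZMod 3) (y : GG), ((a.val : ℤ)) • y = a • y := by decide
  refine has_cons (l := T.toList.map (fun y => (((f y).val : ℤ), y))) (T := 0) ⟨?_, ?_, ?_⟩
    (has_zero _) ?_
  · simp only [ne_eq, List.map_eq_nil_iff, Finset.toList_eq_nil]
    exact Finset.ne_empty_of_mem (Finset.mem_filter.2 ⟨hx, hfx⟩)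
  · intro p hp
    simp only [List.mem_map, Finset.mem_toList] at hp
    obtain ⟨y, hy, rfl⟩ := hp
    exact hval _ (Finset.mem_filter.1 hy).2
  · rw [List.map_map]
    have : ((fun p : ℤ × GG => p.1 • p.2) ∘ fun y => (((f y).val : ℤ), y)) = fun y => f y • y := by
      funext y; exact hsm _ _
    rw [this, Finset.sum_map_toList, ← h1, Finset.sum_filter_of_ne]
    intro y _ hy h0
    apply hy; rw [h0, zero_smul]
  · rw [List.map_map, add_zero]
    have : (Prod.snd ∘ fun y : GG => (((f y).val : ℤ), y)) = id := rfl
    rw [this, List.map_id, Finset.coe_toList]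
    exact Multiset.filter_le _ _

/-- representatives of the 13 points of the projective plane -/
def ptL : List GG :=
  [![1,0,0], ![0,1,0], ![0,0,1], ![1,1,0], ![1,2,0], ![1,0,1], ![1,0,2], ![0,1,1], ![0,1,2],
   ![1,1,1], ![1,1,2], ![1,2,1], ![1,2,2]]

def pt (i : ℕ) : GG := ptL.getD i 0

theorem pt_cover : ∀ x : GG, x ≠ 0 → ∃ i ∈ List.range 13, x = pt i ∨ x = -pt i := by
  decide +kernel

theorem pt_inj : ∀ i ∈ List.range 13, ∀ j ∈ List.range 13, (pt i = pt j ∨ pt i = - pt j) → i = j := by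
  decide +kernel

def col (a b c : GG) : Prop := a + b + c = 0 ∨ a + b - c = 0 ∨ a - b + c = 0 ∨ a - b - c = 0

instance (a b c : GG) : Decidable (col a b c) := by unfold col; infer_instance

theorem col_sign {a b c x y z : GG} (h : col a b c) (hx : x = a ∨ x = -a) (hy : y = b ∨ y = -b)
    (hz : z = c ∨ z = -c) : col x y z := by
  unfold col at *
  rcases hx with rfl | rfl <;> rcases hy with rfl | rfl <;> rcases hz with rfl | rfl <;> grind

theorem col_zs {x y z : GG} (h : col x y z) :
    ∃ l, Zs l ∧ l.map Prod.snd = [x, y, z] := by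
  rcases h with h | h | h | h
  · exact ⟨[(1, x), (1, y), (1, z)], ⟨by simp, by simp, by simp [← h, add_assoc]⟩, rfl⟩
  · exact ⟨[(1, x), (1, y), (2, z)], ⟨by simp, by simp, by
      simp only [List.map_cons, List.map_nil, List.sum_cons, List.sum_nil, add_zero, two_zsmul_GG, one_zsmul]
      rw [← h]; abel⟩, rfl⟩
  · exact ⟨[(1, x), (2, y), (1, z)], ⟨by simp, by simp, by
      simp only [List.map_cons, List.map_nil, List.sum_cons, List.sum_nil, add_zero, two_zsmul_GG, one_zsmul]
      rw [← h]; abel⟩, rfl⟩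
  · exact ⟨[(1, x), (2, y), (2, z)], ⟨by simp, by simp, by
      simp only [List.map_cons, List.map_nil, List.sum_cons, List.sum_nil, add_zero, two_zsmul_GG, one_zsmul]
      rw [← h]; abel⟩, rfl⟩

theorem clean_points (S : Multiset GG) (hS : Clean S) :
    ∃ L : List ℕ, L.Sublist (List.range 13) ∧ L.length = Multiset.card S ∧
      ∃ s : ℕ → GG, (∀ i ∈ L, s i = pt i ∨ s i = -pt i) ∧
        ∀ N : List ℕ, N.Nodup → N ⊆ L → (↑(N.map s) : Multiset GG) ≤ S := by
  classical
  have hcov : ∀ x : GG, ∃ i, x ≠ 0 → i ∈ List.range 13 ∧ (x = pt i ∨ x = -pt i) := by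
    intro x
    by_cases hx : x = 0
    · exact ⟨0, fun h => absurd hx h⟩
    · obtain ⟨i, h⟩ := pt_cover x hx
      exact ⟨i, fun _ => h⟩
  choose idx hidx using hcov
  have hne : ∀ x ∈ S, x ≠ 0 := fun x hx h => hS.1 (h ▸ hx)
  have hinj : ∀ x ∈ S, ∀ y ∈ S, idx x = idx y → x = y := by
    intro x hx y hy h
    have h1 := (hidx x (hne x hx)).2
    have h2 := (hidx y (hne y hy)).2
    rw [← h] at h2
    have : x = y ∨ x = -y := by
      rcases h1 with h1 | h1 <;> rcases h2 with h2 | h2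
      · left; rw [h1, h2]
      · right; rw [h2, neg_neg]; exact h1
      · right; rw [h2]; exact h1
      · left; rw [h1, h2]
    rcases this with h | h
    · exact h
    · exact absurd (h ▸ hx) (hS.2.2 y hy)
  have hnd : (S.map idx).Nodup := hS.2.1.map_on hinj
  have hs : ∀ i, ∃ x, i ∈ S.map idx → x ∈ S ∧ idx x = i := by
    intro i
    by_cases h : i ∈ S.map idx
    · obtain ⟨x, hx⟩ := Multiset.mem_map.1 h
      exact ⟨x, fun _ => hx⟩
    · exact ⟨0, fun h' => absurd h' h⟩
  choose s hs using hs
  let L := (List.range 13).filter (fun i => i ∈ S.map idx)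
  have hLmem : ∀ i, i ∈ L ↔ i ∈ S.map idx := by
    intro i
    simp only [L, List.mem_filter, decide_eq_true_eq, and_iff_right_iff_imp]
    intro h
    obtain ⟨x, hx, rfl⟩ := Multiset.mem_map.1 h
    exact (hidx x (hne x hx)).1
  have hLnd : L.Nodup := List.nodup_range.filter _
  have hLS : (↑L : Multiset ℕ) = S.map idx := by
    rw [Multiset.Nodup.ext (Multiset.coe_nodup.2 hLnd) hnd]
    intro i; rw [Multiset.mem_coe]; exact hLmem i
  refine ⟨L, List.filter_sublist, ?_, s, ?_, ?_⟩
  · rw [← Multiset.coe_card, hLS, Multiset.card_map]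
  · intro i hi
    obtain ⟨h1, h2⟩ := hs i ((hLmem i).1 hi)
    have := (hidx _ (hne _ h1)).2
    rwa [h2] at this
  · intro N hN hNL
    rw [Multiset.le_iff_subset]
    · intro x hx
      rw [Multiset.mem_coe, List.mem_map] at hx
      obtain ⟨i, hi, rfl⟩ := hx
      exact (hs i ((hLmem i).1 (hNL hi))).1
    · rw [Multiset.coe_nodup]
      apply hN.map_on
      intro i hi j hj h
      rw [← (hs i ((hLmem i).1 (hNL hi))).2, h, (hs j ((hLmem j).1 (hNL hj))).2]

/-- all collinear triples of indices -/
def triples : List (ℕ × ℕ × ℕ) :=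
  ((List.range 13).flatMap fun i => (List.range i).flatMap fun j =>
    (List.range j).map fun k => (i, j, k)).filter fun t => decide (col (pt t.1) (pt t.2.1) (pt t.2.2))

def tl (t : ℕ × ℕ × ℕ) : List ℕ := [t.1, t.2.1, t.2.2]

def inside (L : List ℕ) : List (ℕ × ℕ × ℕ) :=
  triples.filter fun t => L.elem t.1 && L.elem t.2.1 && L.elem t.2.2

def disj (t u : ℕ × ℕ × ℕ) : Bool :=
  !((tl u).elem t.1) && !((tl u).elem t.2.1) && !((tl u).elem t.2.2)

def find3 (L : List ℕ) : Bool :=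
  let T := inside L
  T.any fun t => let T' := T.filter (disj t)
    T'.any fun u => T'.any fun v => disj u v

theorem five_check : ((List.range 13).sublistsLen 5).all (fun L => !(inside L).isEmpty) = true := by
  decide +kernel

theorem nine_check : ((List.range 13).sublistsLen 9).all find3 = true := by
  decide +kernel

theorem mem_triples {t : ℕ × ℕ × ℕ} (h : t ∈ triples) :
    col (pt t.1) (pt t.2.1) (pt t.2.2) ∧ (tl t).Nodup := by
  obtain ⟨i, j, k⟩ := t
  simp only [triples, List.mem_filter, List.mem_flatMap, List.mem_map, List.mem_range,
    decide_eq_true_eq] at h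
  obtain ⟨⟨i', hi, j', hj, k', hk, h⟩, hc⟩ := h
  simp only [Prod.mk.injEq] at h
  obtain ⟨rfl, rfl, rfl⟩ := h
  refine ⟨hc, ?_⟩
  simp [tl]
  omega

theorem mem_inside {L : List ℕ} {t : ℕ × ℕ × ℕ} (h : t ∈ inside L) :
    t ∈ triples ∧ tl t ⊆ L := by
  simp only [inside, List.mem_filter, Bool.and_eq_true, List.elem_eq_mem, decide_eq_true_eq] at h
  refine ⟨h.1, ?_⟩
  intro x hx
  simp only [tl, List.mem_cons, List.not_mem_nil, or_false] at hx
  rcases hx with rfl | rfl | rfl <;> tauto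

theorem disj_spec {t u : ℕ × ℕ × ℕ} (h : disj t u = true) : List.Disjoint (tl t) (tl u) := by
  simp only [disj, Bool.and_eq_true, List.elem_eq_mem, Bool.not_eq_true', decide_eq_false_iff_not] at h
  intro x hx hx'
  simp only [tl, List.mem_cons, List.not_mem_nil, or_false] at hx
  rcases hx with rfl | rfl | rfl <;> tauto

theorem triple_zs {L : List ℕ} {s : ℕ → GG} (hs : ∀ i ∈ L, s i = pt i ∨ s i = -pt i)
    {t : ℕ × ℕ × ℕ} (ht : t ∈ inside L) : ∃ l, Zs l ∧ l.map Prod.snd = (tl t).map s := by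
  obtain ⟨h1, h2⟩ := mem_inside ht
  exact col_zs (col_sign (mem_triples h1).1 (hs _ (h2 (by simp [tl]))) (hs _ (h2 (by simp [tl])))
    (hs _ (h2 (by simp [tl]))))

theorem UU_add3 {n m : ℕ} (hU : UU n m) (hn : 2 ≤ n) : UU (n + 3) (m + 1) := by
  refine UU_step hU (by omega) ?_
  intro S hS hc
  obtain ⟨L, hL, hlen, s, hs, hN⟩ := clean_points S hS
  have hk := List.all_eq_true.1 five_check (L.take 5)
    (List.mem_sublistsLen.2 ⟨(List.take_sublist 5 L).trans hL, by simp; omega⟩)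
  have hsub : L.take 5 ⊆ L := (List.take_sublist 5 L).subset
  obtain ⟨t, ht⟩ : ∃ t, t ∈ inside (L.take 5) := by
    apply List.exists_mem_of_ne_nil
    intro h; simp [h] at hk
  obtain ⟨l, hl, hl'⟩ := triple_zs (fun i hi => hs i (hsub hi)) ht
  have hlen3 : l.length = 3 := by
    have := congrArg List.length hl'
    simpa [tl] using this
  obtain ⟨h1, h2⟩ := mem_inside ht
  refine has_remove hl ?_ hU (by omega)
  rw [hl']
  exact hN _ (mem_triples h1).2 (fun x hx => hsub (h2 hx))

theorem UU_two : UU 7 2 := UU_add3 UU_one (by norm_num)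

theorem UU_three : UU 9 3 := by
  refine UU_step UU_two (by norm_num) ?_
  intro S hS hc
  obtain ⟨L, hL, hlen, s, hs, hN⟩ := clean_points S hS
  have hk := List.all_eq_true.1 nine_check (L.take 9)
    (List.mem_sublistsLen.2 ⟨(List.take_sublist 9 L).trans hL, by simp; omega⟩)
  have hsub : L.take 9 ⊆ L := (List.take_sublist 9 L).subset
  simp only [find3, List.any_eq_true, List.mem_filter] at hk
  obtain ⟨t, ht, u, ⟨hu, htu⟩, v, ⟨hv, htv⟩, huv⟩ := hk
  obtain ⟨a, ha, ha'⟩ := triple_zs (fun i hi => hs i (hsub hi)) ht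
  obtain ⟨b, hb, hb'⟩ := triple_zs (fun i hi => hs i (hsub hi)) hu
  obtain ⟨c, hc, hc'⟩ := triple_zs (fun i hi => hs i (hsub hi)) hv
  obtain ⟨ht1, ht2⟩ := mem_inside ht
  obtain ⟨hu1, hu2⟩ := mem_inside hu
  obtain ⟨hv1, hv2⟩ := mem_inside hv
  have h1 := has_cons hc (has_zero 0) le_rfl
  have h2 := has_cons hb h1 le_rfl
  refine has_cons ha h2 ?_
  rw [ha', hb', hc', add_zero, Multiset.coe_add, Multiset.coe_add, ← List.map_append,
    ← List.map_append]
  apply hN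
  · refine List.Nodup.append (mem_triples ht1).2
      (List.Nodup.append (mem_triples hu1).2 (mem_triples hv1).2 (disj_spec huv)) ?_
    rw [List.disjoint_append_right]
    exact ⟨disj_spec htu, disj_spec htv⟩
  · intro x hx
    apply hsub
    rcases List.mem_append.1 hx with hx | hx
    · exact ht2 hx
    · rcases List.mem_append.1 hx with hx | hx
      · exact hu2 hx
      · exact hv2 hx

theorem UU_four : UU 12 4 := UU_add3 UU_three (by norm_num)

theorem UU_add2 {n m : ℕ} (hU : UU n m) (hn : 12 ≤ n) : UU (n + 2) (m + 1) := by
  refine UU_step hU le_rfl ?_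
  intro S hS hc
  obtain ⟨L, hL, hlen, -⟩ := clean_points S hS
  have := hL.length_le
  simp at this
  omega

theorem UU_ge (k : ℕ) : UU (14 + 2 * k) (5 + k) := by
  induction k with
  | zero => exact UU_add2 UU_four le_rfl
  | succ k ih => exact UU_add2 ih (show 12 ≤ 14 + 2 * k by omega)

theorem lower (u : GG → ℕ) (K : ℕ) (S : Multiset GG) (m : ℕ)
    (h : ∀ l, Zs l → (↑(l.map Prod.snd) : Multiset GG) ≤ S → K ≤ ((l.map Prod.snd).map u).sum)
    (hS : (S.map u).sum < K * m) : ¬ HasDisjointWZeroSubsums {1, 2} S m := by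
  rintro ⟨ls, h1, h2, h3⟩
  have key : ∀ ls : List (List (ℤ × GG)), (∀ l ∈ ls, K ≤ ((l.map Prod.snd).map u).sum) →
      K * ls.length ≤ ((ls.flatten.map Prod.snd).map u).sum := by
    intro ls
    induction ls with
    | nil => simp
    | cons a t ih =>
      intro hh
      have e1 := hh a (by simp)
      have e2 := ih (fun l hl => hh l (by simp [hl]))
      simp only [List.flatten_cons, List.map_append, List.sum_append, List.length_cons]
      rw [mul_add, mul_one]
      omega
  have hk := key ls (fun l hl => h l (h2 l hl) (by
    refine le_trans ?_ h3
    rw [Multiset.coe_le]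
    exact ((List.sublist_flatten_of_mem hl).map _).subperm))
  obtain ⟨T, hT⟩ := Multiset.le_iff_exists_add.1 h3
  rw [hT, Multiset.map_add, Multiset.sum_add, Multiset.map_coe, Multiset.sum_coe] at hS
  rw [h1] at hk
  omega

theorem DW_eq {n m : ℕ} (hU : UU (n + 1) m) (S : Multiset GG) (hc : Multiset.card S = n)
    (hS : ¬ HasDisjointWZeroSubsums {1, 2} S m) : DW {1, 2} GG m = n + 1 := by
  unfold DW
  apply le_antisymm
  · exact Nat.sInf_le hU
  · apply le_csInf ⟨_, hU⟩
    intro b hb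
    by_contra hlt
    exact hS (hb S (by omega))

/-- signs as a finite decidable list -/
theorem zs_two {x y : GG} {a b : ℤ} (h : Zs [(a, x), (b, y)]) : x = y ∨ x = -y := by
  obtain ⟨-, h1, h2⟩ := h
  have ha : a = 1 ∨ a = 2 := h1 (a, x) (by simp)
  have hb : b = 1 ∨ b = 2 := h1 (b, y) (by simp)
  simp only [List.map_cons, List.map_nil, List.sum_cons, List.sum_nil, add_zero] at h2
  rcases ha with rfl | rfl <;> rcases hb with rfl | rfl <;>
    simp only [two_zsmul_GG, one_zsmul] at h2 <;> grind

theorem zs_one {x : GG} {a : ℤ} (h : Zs [(a, x)]) : x = 0 := by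
  obtain ⟨-, h1, h2⟩ := h
  have ha : a = 1 ∨ a = 2 := h1 (a, x) (by simp)
  simp only [List.map_cons, List.map_nil, List.sum_cons, List.sum_nil, add_zero] at h2
  rcases ha with rfl | rfl <;> simp only [two_zsmul_GG, one_zsmul] at h2 <;> grind

theorem zs_three {x y z : GG} {a b c : ℤ} (h : Zs [(a, x), (b, y), (c, z)]) : col x y z := by
  obtain ⟨-, h1, h2⟩ := h
  have ha : a = 1 ∨ a = 2 := h1 (a, x) (by simp)
  have hb : b = 1 ∨ b = 2 := h1 (b, y) (by simp)
  have hc : c = 1 ∨ c = 2 := h1 (c, z) (by simp)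
  unfold col
  simp only [List.map_cons, List.map_nil, List.sum_cons, List.sum_nil, add_zero] at h2
  rcases ha with rfl | rfl <;> rcases hb with rfl | rfl <;> rcases hc with rfl | rfl <;>
    simp only [two_zsmul_GG, one_zsmul] at h2 <;> grind

def g0 : GG := ![1, 0, 0]

def u0 (x : GG) : ℕ := if x = g0 then 3 else 2

theorem u0_ge (x : GG) : 2 ≤ u0 x := by unfold u0; split <;> norm_num

theorem ptL_zero : ∀ x ∈ ptL, x ≠ 0 := by decide +kernel

theorem ptL_pair : ∀ x ∈ ptL, ∀ y ∈ ptL, (x = y ∨ x = -y) → x = y := by decide +kernel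

theorem ptL_nodup : ptL.Nodup := by decide +kernel

theorem lower_pts (k : ℕ) (R : Multiset GG) (hR : R ≤ ↑ptL) (l : List (ℤ × GG)) (hl : Zs l)
    (h : (↑(l.map Prod.snd) : Multiset GG) ≤ R + Multiset.replicate k g0) :
    6 ≤ ((l.map Prod.snd).map u0).sum := by
  have hmem : ∀ p ∈ l, p.2 ∈ ptL := by
    intro p hp
    have : p.2 ∈ R + Multiset.replicate k g0 :=
      Multiset.mem_of_le h (by rw [Multiset.mem_coe]; exact List.mem_map_of_mem hp)
    rcases Multiset.mem_add.1 this with h | h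
    · exact Multiset.mem_coe.1 (Multiset.mem_of_le hR h)
    · rw [Multiset.eq_of_mem_replicate h]; decide +kernel
  match l, hl with
  | [], hl => exact absurd rfl hl.1
  | [(a, x)], hl => exact absurd (zs_one hl) (ptL_zero x (hmem (a, x) (by simp)))
  | [(a, x), (b, y)], hl =>
    have hxy := ptL_pair x (hmem (a, x) (by simp)) y (hmem (b, y) (by simp)) (zs_two hl)
    subst hxy
    have hg : x = g0 := by
      by_contra hne
      have h1 := Multiset.count_le_of_le x h
      rw [Multiset.count_add, Multiset.count_replicate, if_neg (Ne.symm hne)] at h1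
      have h2 := (Multiset.count_le_of_le x hR).trans
        (Multiset.nodup_iff_count_le_one.1 (Multiset.coe_nodup.2 ptL_nodup) x)
      simp at h1
      omega
    subst hg
    simp [u0]
  | p :: q :: r :: t, hl =>
    have h1 := u0_ge p.2
    have h2 := u0_ge q.2
    have h3 := u0_ge r.2
    simp only [List.map_cons, List.sum_cons]
    omega

def ex1 : List GG := [![1,0,0], ![0,1,0], ![0,0,1]]

def ex2 : List GG := [![1,0,0], ![0,1,0], ![0,0,1], ![1,1,0], ![0,1,1], ![1,0,1]]

def u2 (x : GG) : ℕ := if x ∈ ex1 then 3 else 2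

theorem u2_ge (x : GG) : 2 ≤ u2 x := by unfold u2; split <;> norm_num

theorem ex2_zero : ∀ x ∈ ex2, x ≠ 0 := by decide +kernel

theorem ex2_pair : ∀ x ∈ ex2, ∀ y ∈ ex2, x ≠ y → ¬ (x = y ∨ x = -y) := by decide +kernel

theorem ex2_triple : ∀ x ∈ ex2, ∀ y ∈ ex2, ∀ z ∈ ex2, x ≠ y → x ≠ z → y ≠ z → col x y z →
    8 ≤ u2 x + u2 y + u2 z := by decide +kernel

theorem ex1_triple : ∀ x ∈ ex1, ∀ y ∈ ex1, ∀ z ∈ ex1, x ≠ y → x ≠ z → y ≠ z → ¬ col x y z := by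
  decide +kernel

theorem ex2_nodup : ex2.Nodup := by decide +kernel

theorem ex1_sub : ex1.Sublist ex2 := by decide +kernel

theorem lower_ex2 (l : List (ℤ × GG)) (hl : Zs l)
    (h : (↑(l.map Prod.snd) : Multiset GG) ≤ ↑ex2) :
    8 ≤ ((l.map Prod.snd).map u2).sum := by
  have hmem : ∀ x ∈ l.map Prod.snd, x ∈ ex2 := fun x hx => Multiset.mem_of_le h hx
  have hnd : (l.map Prod.snd).Nodup :=
    Multiset.coe_nodup.1 (Multiset.nodup_of_le h (Multiset.coe_nodup.2 ex2_nodup))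
  match l, hl with
  | [], hl => exact absurd rfl hl.1
  | [(a, x)], hl => exact absurd (zs_one hl) (ex2_zero x (hmem x (by simp)))
  | [(a, x), (b, y)], hl =>
    simp at hnd
    exact absurd (zs_two hl) (ex2_pair x (hmem x (by simp)) y (hmem y (by simp)) hnd)
  | [(a, x), (b, y), (c, z)], hl =>
    simp at hnd
    have := ex2_triple x (hmem x (by simp)) y (hmem y (by simp)) z (hmem z (by simp)) hnd.1.1
      hnd.1.2 hnd.2 (zs_three hl)
    simp
    omega
  | p :: q :: r :: s :: t, hl =>
    have h1 := u2_ge p.2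
    have h2 := u2_ge q.2
    have h3 := u2_ge r.2
    have h4 := u2_ge s.2
    simp only [List.map_cons, List.sum_cons]
    omega

theorem lower_ex1 (l : List (ℤ × GG)) (hl : Zs l)
    (h : (↑(l.map Prod.snd) : Multiset GG) ≤ ↑ex1) :
    4 ≤ ((l.map Prod.snd).map (fun _ => 1)).sum := by
  have hs := ex1_sub
  have hmem : ∀ x ∈ l.map Prod.snd, x ∈ ex1 := fun x hx => Multiset.mem_of_le h hx
  have hmem2 : ∀ x ∈ l.map Prod.snd, x ∈ ex2 := fun x hx => hs.subset (hmem x hx)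
  have hnd : (l.map Prod.snd).Nodup :=
    Multiset.coe_nodup.1 (Multiset.nodup_of_le h (Multiset.coe_nodup.2 (ex2_nodup.sublist hs)))
  match l, hl with
  | [], hl => exact absurd rfl hl.1
  | [(a, x)], hl => exact absurd (zs_one hl) (ex2_zero x (hmem2 x (by simp)))
  | [(a, x), (b, y)], hl =>
    simp at hnd
    exact absurd (zs_two hl) (ex2_pair x (hmem2 x (by simp)) y (hmem2 y (by simp)) hnd)
  | [(a, x), (b, y), (c, z)], hl =>
    simp at hnd
    exact absurd (zs_three hl) (ex1_triple x (hmem x (by simp)) y (hmem y (by simp)) z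
      (hmem z (by simp)) hnd.1.1 hnd.1.2 hnd.2)
  | p :: q :: r :: s :: t, hl =>
    simp only [List.map_cons, List.sum_cons]
    omega

theorem low_pts (n m : ℕ) (hn : n ≤ 13) (h : 2 * n + 1 < 6 * m) :
    ¬ HasDisjointWZeroSubsums {1, 2} (↑(ptL.take n) : Multiset GG) m := by
  have hle : (↑(ptL.take n) : Multiset GG) ≤ ↑ptL :=
    Multiset.coe_le.2 (List.take_sublist _ _).subperm
  apply lower u0 6
  · intro l hl hl'
    exact lower_pts 0 _ hle l hl (by simpa using hl')
  · have : ∀ n ≤ 13, ((ptL.take n).map u0).sum ≤ 2 * n + 1 := by decide +kernel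
    have := this n hn
    rw [Multiset.map_coe, Multiset.sum_coe]
    omega

theorem low_ge (k : ℕ) : ¬ HasDisjointWZeroSubsums {1, 2}
    ((↑ptL : Multiset GG) + Multiset.replicate (2 * k) g0) (5 + k) := by
  apply lower u0 6
  · intro l hl hl'
    exact lower_pts _ _ le_rfl l hl hl'
  · have h : (ptL.map u0).sum = 27 := by decide +kernel
    rw [Multiset.map_add, Multiset.sum_add, Multiset.map_coe, Multiset.sum_coe, h,
      Multiset.map_replicate, Multiset.sum_replicate]
    simp [u0]
    omega

/-- the fully weighted multi-wise Davenport constants of `C_3^3`: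
`D_{A,1} = 4`, `D_{A,2} = 7`, `D_{A,3} = 9`, `D_{A,4} = 12`, and `D_{A,m} = 4 + 2m`
for `m ≥ 5`, where `A = {1,2}`. -/
theorem stmt18 :
    DW {1, 2} (Fin 3 → ZMod 3) 1 = 4 ∧
    DW {1, 2} (Fin 3 → ZMod 3) 2 = 7 ∧
    DW {1, 2} (Fin 3 → ZMod 3) 3 = 9 ∧
    DW {1, 2} (Fin 3 → ZMod 3) 4 = 12 ∧
    ∀ m : ℕ, 5 ≤ m → DW {1, 2} (Fin 3 → ZMod 3) m = 4 + 2 * m := by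
  refine ⟨?_, ?_, ?_, ?_, ?_⟩
  · exact DW_eq UU_one ↑ex1 rfl (lower (fun _ => 1) 4 _ _ lower_ex1 (by decide +kernel))
  · exact DW_eq UU_two ↑ex2 rfl (lower u2 8 _ _ lower_ex2 (by decide +kernel))
  · exact DW_eq UU_three ↑(ptL.take 8) rfl (low_pts 8 3 (by norm_num) (by norm_num))
  · exact DW_eq UU_four ↑(ptL.take 11) rfl (low_pts 11 4 (by norm_num) (by norm_num))
  · intro m hm
    obtain ⟨k, rfl⟩ := Nat.exists_eq_add_of_le hm
    have h := DW_eq (n := 13 + 2 * k) (m := 5 + k)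
      (by have := UU_ge k; rwa [show 13 + 2 * k + 1 = 14 + 2 * k by ring])
      ((↑ptL : Multiset GG) + Multiset.replicate (2 * k) g0) (by simp [ptL]) (low_ge k)
    rw [h]; ring
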